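/- arXiv:1604.04841 — 6 statements merged into one kernel-verified Lean document; each statement's English description precedes it below -/
import Mathlib

section
/- If the constraint set F is nonempty, then its recession cone satisfies 0⁺F = {v ∈ H : T_i v = 0 and ⟨c_i, v⟩ ≤ 0 for all i = 1,…,m}. -/
open scoped RealInnerProductSpace
open Filter Topology

/-- A sequence `x` in a real inner product space converges weakly to `x₀` if
`⟪a, x k⟫ → ⟪a, x₀⟫` for every `a`. -/
def WeaklyConvergesTo {H : Type*} [NormedAddCommGroup H] [InnerProductSpace ℝ H]
    (x : ℕ → H) (x₀ : H) : Prop :=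
  ∀ a : H, Tendsto (fun k => ⟪a, x k⟫) atTop (𝓝 ⟪a, x₀⟫)

/-- The recession cone `0⁺X = {v | x + t • v ∈ X for all x ∈ X and t ≥ 0}`. -/
def recessionCone {H : Type*} [NormedAddCommGroup H] [InnerProductSpace ℝ H]
    (X : Set H) : Set H :=
  {v | ∀ x ∈ X, ∀ t : ℝ, 0 ≤ t → x + t • v ∈ X}

/-- A quadratic polynomial with nonnegative leading coefficient that is bounded above on
`[0, ∞)` by `0` has zero leading coefficient and nonpositive linear coefficient. -/
theorem eq_zero_and_nonpos_of_quadratic_nonpos {a b c : ℝ} (ha : 0 ≤ a)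
    (h : ∀ t : ℝ, 0 ≤ t → a * (t * t) + b * t + c ≤ 0) : a = 0 ∧ b ≤ 0 := by
  constructor
  · by_contra hne
    have ha' : 0 < a := lt_of_le_of_ne ha (Ne.symm hne)
    have hs : 0 ≤ (|b| + |c|) / a := by positivity
    have hsa : a * ((|b| + |c|) / a) = |b| + |c| := by field_simp
    generalize (|b| + |c|) / a = s at hs hsa
    have ht := h (1 + s) (by linarith)
    nlinarith [neg_abs_le b, neg_abs_le c, mul_nonneg hs (abs_nonneg c), mul_nonneg hs ha,
      mul_nonneg hs (neg_le_iff_add_nonneg.mp (neg_abs_le b)),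
      congrArg (fun r => s * r) hsa]
  · by_contra! hb
    have ht := h ((|c| + 1) / b) (by positivity)
    have hbt : b * ((|c| + 1) / b) = |c| + 1 := by field_simp
    nlinarith [neg_abs_le c, mul_nonneg ha (mul_self_nonneg ((|c| + 1) / b))]

section QuadraticForm

variable {H : Type*} [NormedAddCommGroup H] [InnerProductSpace ℝ H]

theorem inner_add_smul_map_add_smul {T : H →L[ℝ] H} (hT : ∀ x y : H, ⟪T x, y⟫ = ⟪x, T y⟫)
    (x v : H) (t : ℝ) :
    ⟪x + t • v, T (x + t • v)⟫ = ⟪v, T v⟫ * (t * t) + 2 * ⟪x, T v⟫ * t + ⟪x, T x⟫ := by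
  have hvx : ⟪v, T x⟫ = ⟪x, T v⟫ := by rw [real_inner_comm, hT]
  simp only [map_add, map_smul, inner_add_left, inner_add_right, real_inner_smul_left,
    real_inner_smul_right, hvx]
  ring

theorem map_eq_zero_of_inner_map_eq_zero {T : H →L[ℝ] H}
    (hT : ∀ x y : H, ⟪T x, y⟫ = ⟪x, T y⟫) (hpos : ∀ x : H, 0 ≤ ⟪x, T x⟫) {v : H}
    (hv : ⟪v, T v⟫ = 0) : T v = 0 := by
  have hdisc := discrim_le_zero fun t : ℝ =>
    (inner_add_smul_map_add_smul hT v (T v) t).subst (motive := fun r => 0 ≤ r)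
      (hpos (v + t • T v))
  rw [discrim, hv, ← hT v (T v)] at hdisc
  have hsq : ⟪T v, T v⟫ ^ 2 ≤ 0 := by linarith
  exact inner_self_eq_zero.mp (pow_eq_zero_iff two_ne_zero |>.mp (le_antisymm hsq (sq_nonneg _)))

end QuadraticForm

/-- If the constraint set `F` is nonempty, then its recession cone is
`{v | Tᵢ v = 0 and ⟪cᵢ, v⟫ ≤ 0 for all i}`. -/
theorem recessionCone_constraint_set
    {H : Type*} [NormedAddCommGroup H] [InnerProductSpace ℝ H] [CompleteSpace H]
    {m : ℕ} (Ti : Fin m → H →L[ℝ] H)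
    (hTi_sa : ∀ i, ∀ x y : H, ⟪Ti i x, y⟫ = ⟪x, Ti i y⟫)
    (hTi_pos : ∀ i, ∀ x : H, 0 ≤ ⟪x, Ti i x⟫)
    (ci : Fin m → H) (α : Fin m → ℝ)
    (F : Set H)
    (hF : F = {x : H | ∀ i, (1/2 : ℝ) * ⟪x, Ti i x⟫ + ⟪ci i, x⟫ + α i ≤ 0})
    (hne : F.Nonempty) :
    recessionCone F = {v : H | ∀ i, Ti i v = 0 ∧ ⟪ci i, v⟫ ≤ 0} := by
  subst hF
  ext v
  constructor
  · intro hv i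
    obtain ⟨x, hx⟩ := hne
    have hquad : ∀ t : ℝ, 0 ≤ t → (1 / 2 * ⟪v, Ti i v⟫) * (t * t) +
        (⟪x, Ti i v⟫ + ⟪ci i, v⟫) * t + (1 / 2 * ⟪x, Ti i x⟫ + ⟪ci i, x⟫ + α i) ≤ 0 := by
      intro t ht
      have hxt := hv x hx t ht i
      rw [inner_add_smul_map_add_smul (hTi_sa i), inner_add_right,
        real_inner_smul_right] at hxt
      linarith
    obtain ⟨hvv, hlin⟩ :=
      eq_zero_and_nonpos_of_quadratic_nonpos (by linarith [hTi_pos i v]) hquad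
    have hTv : Ti i v = 0 :=
      map_eq_zero_of_inner_map_eq_zero (hTi_sa i) (hTi_pos i) (by linarith)
    rw [hTv, inner_zero_right, zero_add] at hlin
    exact ⟨hTv, hlin⟩
  · intro hv x hx t ht i
    obtain ⟨hTv, hcv⟩ := hv i
    have hxi := hx i
    rw [inner_add_smul_map_add_smul (hTi_sa i), inner_add_right, real_inner_smul_right, hTv,
      inner_zero_right, inner_zero_right]
    linarith [mul_nonpos_of_nonneg_of_nonpos ht hcv]
end

section
/- Let a ∈ ℝ and let S_a = {x ∈ F : f(x) ≤ a}. If the quadratic form x ↦ ⟨x, T x⟩ is weakly sequentially lower semicontinuous and S_a is nonempty, then S_a contains an element of minimal norm, i.e., there exists ȳ ∈ S_a with ‖ȳ‖ ≤ ‖y‖ for all y ∈ S_a. -/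
open scoped RealInnerProductSpace
open Filter Topology

/-- A bounded sequence in a Hilbert space has a weakly convergent subsequence. -/
theorem exists_weaklyConvergesTo_subseq {H : Type*} [NormedAddCommGroup H]
    [InnerProductSpace ℝ H] [CompleteSpace H] {x : ℕ → H} {R : ℝ} (hR : ∀ k, ‖x k‖ ≤ R) :
    ∃ (x₀ : H) (φ : ℕ → ℕ), StrictMono φ ∧ WeaklyConvergesTo (x ∘ φ) x₀ := by
  let V : Submodule ℝ H := (Submodule.span ℝ (Set.range x)).topologicalClosure
  have hxV (k : ℕ) : x k ∈ V :=
    Submodule.le_topologicalClosure _ (Submodule.subset_span (Set.mem_range_self k))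
  have : CompleteSpace V := (Submodule.isClosed_topologicalClosure _).completeSpace_coe
  have : TopologicalSpace.SeparableSpace V :=
    (Set.countable_range x).isSeparable.span.closure.separableSpace
  let y (k : ℕ) : WeakDual ℝ V :=
    StrongDual.toWeakDual (InnerProductSpace.toDual ℝ V ⟨x k, hxV k⟩)
  have hy (k : ℕ) : y k ∈ WeakDual.toStrongDual ⁻¹' Metric.closedBall (0 : StrongDual ℝ V) R := by
    change InnerProductSpace.toDual ℝ V ⟨x k, hxV k⟩ ∈ Metric.closedBall _ _
    rw [mem_closedBall_zero_iff, LinearIsometryEquiv.norm_map]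
    exact hR k
  obtain ⟨g, -, φ, hφ, hg⟩ := WeakDual.isSeqCompact_closedBall ℝ V 0 R hy
  refine ⟨(InnerProductSpace.toDual ℝ V).symm (WeakDual.toStrongDual g), φ, hφ, fun a => ?_⟩
  have key (v : V) : ⟪a, (v : H)⟫ = ⟪v, V.orthogonalProjectionOnto a⟫ := by
    rw [real_inner_comm, V.inner_orthogonalProjectionOnto_eq_of_mem_left]
  have h := ((WeakDual.eval_continuous (V.orthogonalProjectionOnto a)).tendsto g).comp hg
  rw [key, InnerProductSpace.toDual_symm_apply]
  exact h.congr fun k => (key ⟨x (φ k), hxV (φ k)⟩).symm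

namespace WeaklyConvergesTo

variable {H : Type*} [NormedAddCommGroup H] [InnerProductSpace ℝ H] {x : ℕ → H} {x₀ : H}

/-- The norm is weakly sequentially lower semicontinuous. -/
theorem norm_le_of_tendsto (hx : WeaklyConvergesTo x x₀) {r : ℝ}
    (hr : Tendsto (fun k => ‖x k‖) atTop (𝓝 r)) : ‖x₀‖ ≤ r := by
  have h : ⟪x₀, x₀⟫ ≤ ‖x₀‖ * r :=
    le_of_tendsto_of_tendsto' (hx x₀) (hr.const_mul ‖x₀‖) fun k => real_inner_le_norm _ _
  rw [real_inner_self_eq_norm_mul_norm] at h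
  rcases (norm_nonneg x₀).eq_or_lt with h0 | h0
  · rw [← h0]
    exact ge_of_tendsto' hr fun k => norm_nonneg _
  · exact le_of_mul_le_mul_left h h0

/-- Sublevel sets of a convex quadratic function are weakly sequentially closed. -/
theorem quadratic_nonpos (hx : WeaklyConvergesTo x x₀) {A : H →L[ℝ] H}
    (hA : ∀ u v : H, ⟪A u, v⟫ = ⟪u, A v⟫) (hA_pos : ∀ u : H, 0 ≤ ⟪u, A u⟫) {b : H} {β : ℝ}
    (h : ∀ k, (1/2 : ℝ) * ⟪x k, A (x k)⟫ + ⟪b, x k⟫ + β ≤ 0) :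
    (1/2 : ℝ) * ⟪x₀, A x₀⟫ + ⟪b, x₀⟫ + β ≤ 0 := by
  have hlim : Tendsto (fun k => ⟪A x₀, x k⟫ - (1/2 : ℝ) * ⟪x₀, A x₀⟫ + ⟪b, x k⟫ + β) atTop
      (𝓝 (⟪A x₀, x₀⟫ - (1/2 : ℝ) * ⟪x₀, A x₀⟫ + ⟪b, x₀⟫ + β)) :=
    (((hx (A x₀)).sub_const _).add (hx b)).add_const β
  have hle := le_of_tendsto' (b := 0) hlim fun k => by
    have hpos := hA_pos (x k - x₀)
    have hcomm : ⟪x k, A x₀⟫ = ⟪A x₀, x k⟫ := real_inner_comm _ _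
    simp only [map_sub, inner_sub_left, inner_sub_right] at hpos
    linarith [h k, hA x₀ (x k)]
  linarith [hA x₀ x₀]

/-- Sublevel sets of a quadratic function are weakly sequentially closed along bounded sequences
on which the quadratic form is weakly lower semicontinuous. -/
theorem quadratic_le_of_le_liminf (hx : WeaklyConvergesTo x x₀) {A : H →L[ℝ] H} {R : ℝ}
    (hR : ∀ k, ‖x k‖ ≤ R) (hA : ⟪x₀, A x₀⟫ ≤ liminf (fun k => ⟪x k, A (x k)⟫) atTop) {b : H}
    {β : ℝ} (h : ∀ k, (1/2 : ℝ) * ⟪x k, A (x k)⟫ + ⟪b, x k⟫ ≤ β) :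
    (1/2 : ℝ) * ⟪x₀, A x₀⟫ + ⟪b, x₀⟫ ≤ β := by
  have hlim : Tendsto (fun k => 2 * (β - ⟪b, x k⟫)) atTop (𝓝 (2 * (β - ⟪b, x₀⟫))) :=
    ((hx b).const_sub β).const_mul 2
  have hbdd (k : ℕ) : -(R * (‖A‖ * R)) ≤ ⟪x k, A (x k)⟫ := by
    have hR0 : 0 ≤ R := (norm_nonneg _).trans (hR k)
    refine (abs_le.mp ((abs_real_inner_le_norm _ _).trans ?_)).1
    exact mul_le_mul (hR k) (A.le_opNorm_of_le (hR k)) (norm_nonneg _) hR0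
  have hle : liminf (fun k => ⟪x k, A (x k)⟫) atTop ≤ 2 * (β - ⟪b, x₀⟫) := by
    rw [← hlim.liminf_eq]
    exact liminf_le_liminf (Eventually.of_forall fun k => by linarith [h k])
      (isBoundedUnder_of_eventually_ge (Eventually.of_forall hbdd))
      hlim.isBoundedUnder_le.isCoboundedUnder_ge
  linarith

end WeaklyConvergesTo

/-- If the quadratic form `x ↦ ⟪x, T x⟫` is weakly sequentially lower semicontinuous and the
sublevel set `S_a = {x ∈ F | f x ≤ a}` is nonempty, then `S_a` has an element of minimal norm. -/
theorem sublevel_set_minimal_norm_element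
    {H : Type*} [NormedAddCommGroup H] [InnerProductSpace ℝ H] [CompleteSpace H]
    {m : ℕ} (T : H →L[ℝ] H) (hT_sa : ∀ x y : H, ⟪T x, y⟫ = ⟪x, T y⟫) (c : H)
    (Ti : Fin m → H →L[ℝ] H)
    (hTi_sa : ∀ i, ∀ x y : H, ⟪Ti i x, y⟫ = ⟪x, Ti i y⟫)
    (hTi_pos : ∀ i, ∀ x : H, 0 ≤ ⟪x, Ti i x⟫)
    (ci : Fin m → H) (α : Fin m → ℝ)
    (f : H → ℝ) (hf : ∀ x, f x = (1/2 : ℝ) * ⟪x, T x⟫ + ⟪c, x⟫)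
    (F : Set H)
    (hF : F = {x : H | ∀ i, (1/2 : ℝ) * ⟪x, Ti i x⟫ + ⟪ci i, x⟫ + α i ≤ 0})
    (hwlsc : ∀ (x : ℕ → H) (x₀ : H), WeaklyConvergesTo x x₀ →
      ⟪x₀, T x₀⟫ ≤ Filter.liminf (fun k => ⟪x k, T (x k)⟫) Filter.atTop)
    (a : ℝ) (S : Set H) (hS : S = {x ∈ F | f x ≤ a})
    (hSne : S.Nonempty) :
    ∃ ybar ∈ S, ∀ y ∈ S, ‖ybar‖ ≤ ‖y‖ := by
  obtain ⟨u, -, hu, huS⟩ := exists_seq_tendsto_sInf (hSne.image norm)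
    ⟨0, Set.forall_mem_image.2 fun y _ => norm_nonneg y⟩
  choose x hxS hxu using huS
  obtain rfl : (fun k => ‖x k‖) = u := funext hxu
  obtain ⟨R, hR⟩ := hu.bddAbove_range
  replace hR (k : ℕ) : ‖x k‖ ≤ R := hR (Set.mem_range_self k)
  obtain ⟨x₀, φ, hφ, hx₀⟩ := exists_weaklyConvergesTo_subseq hR
  refine ⟨x₀, ?_, fun y hy => (hx₀.norm_le_of_tendsto (hu.comp hφ.tendsto_atTop)).trans
    (csInf_le ⟨0, Set.forall_mem_image.2 fun y _ => norm_nonneg y⟩ (Set.mem_image_of_mem _ hy))⟩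
  subst hS hF
  refine ⟨fun i => hx₀.quadratic_nonpos (hTi_sa i) (hTi_pos i) fun k => (hxS (φ k)).1 i, ?_⟩
  rw [hf]
  exact hx₀.quadratic_le_of_le_liminf (fun k => hR (φ k)) (hwlsc _ _ hx₀) fun k =>
    (hf _).symm.trans_le (hxS (φ k)).2
end

section
/- Let x^k be a sequence in F with x^k ≠ 0 for all k and ‖x^k‖ → ∞. If the normalized sequence x^k/‖x^k‖ converges weakly to v̄, then v̄ belongs to the recession cone 0⁺F, i.e., T_i v̄ = 0 and ⟨c_i, v̄⟩ ≤ 0 for all i = 1,…,m. -/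
open scoped RealInnerProductSpace
open Filter Topology

/-- A vector annihilated by the quadratic form of a symmetric positive semidefinite operator lies
in the kernel of that operator. -/
theorem apply_eq_zero_of_inner_self_apply_eq_zero
    {H : Type*} [NormedAddCommGroup H] [InnerProductSpace ℝ H] (T : H →L[ℝ] H)
    (hsa : ∀ x y : H, ⟪T x, y⟫ = ⟪x, T y⟫) (hpos : ∀ x : H, 0 ≤ ⟪x, T x⟫)
    {v : H} (hv : ⟪v, T v⟫ = 0) : T v = 0 := by
  have h : ∀ t : ℝ, 0 ≤ ⟪T v, T (T v)⟫ * (t * t) + (2 * ⟪T v, T v⟫) * t + 0 := fun t => by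
    have := hpos (v + t • T v)
    simp only [map_add, map_smul, inner_add_left, inner_add_right, real_inner_smul_left,
      real_inner_smul_right, hv, ← hsa v (T v)] at this
    linarith
  have hd := discrim_le_zero h
  simp only [discrim] at hd
  have h0 : ⟪T v, T v⟫ = 0 := by nlinarith [sq_nonneg ⟪T v, T v⟫]
  exact inner_self_eq_zero.1 h0

/-- If `x k ∈ F`, `x k ≠ 0`, `‖x k‖ → ∞` and the normalized sequence `x k / ‖x k‖` converges
weakly to `v₀`, then `v₀` belongs to the recession cone of `F`, i.e. `Tᵢ v₀ = 0` and
`⟪cᵢ, v₀⟫ ≤ 0` for all `i`. -/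
theorem weak_limit_of_normalized_in_recessionCone
    {H : Type*} [NormedAddCommGroup H] [InnerProductSpace ℝ H] [CompleteSpace H]
    {m : ℕ} (Ti : Fin m → H →L[ℝ] H)
    (hTi_sa : ∀ i, ∀ x y : H, ⟪Ti i x, y⟫ = ⟪x, Ti i y⟫)
    (hTi_pos : ∀ i, ∀ x : H, 0 ≤ ⟪x, Ti i x⟫)
    (ci : Fin m → H) (α : Fin m → ℝ)
    (F : Set H)
    (hF : F = {x : H | ∀ i, (1/2 : ℝ) * ⟪x, Ti i x⟫ + ⟪ci i, x⟫ + α i ≤ 0})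
    (x : ℕ → H) (hxF : ∀ k, x k ∈ F) (hx0 : ∀ k, x k ≠ 0)
    (hnorm : Tendsto (fun k => ‖x k‖) atTop atTop)
    (v₀ : H) (hw : WeaklyConvergesTo (fun k => ‖x k‖⁻¹ • x k) v₀) :
    v₀ ∈ recessionCone F ∧ ∀ i, Ti i v₀ = 0 ∧ ⟪ci i, v₀⟫ ≤ 0 := by
  have key : ∀ i, Ti i v₀ = 0 ∧ ⟪ci i, v₀⟫ ≤ 0 := by
    intro i
    have hinv : Tendsto (fun k => ‖x k‖⁻¹) atTop (𝓝 0) := hnorm.inv_tendsto_atTop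
    have hg : ∀ k, (1/2 : ℝ) * ⟪x k, Ti i (x k)⟫ + ⟪ci i, x k⟫ + α i ≤ 0 := fun k => by
      have := hxF k
      rw [hF] at this
      exact this i
    have hc : ⟪ci i, v₀⟫ ≤ 0 := by
      refine le_of_tendsto_of_tendsto' (hw (ci i))
        (by simpa using hinv.const_mul (-α i)) fun k => ?_
      rw [real_inner_smul_right]
      have hp : 0 ≤ ‖x k‖⁻¹ := by positivity
      nlinarith [mul_le_mul_of_nonneg_left (hg k) hp, mul_nonneg hp (hTi_pos i (x k))]
    have hq : 2 * ⟪Ti i v₀, v₀⟫ - ⟪v₀, Ti i v₀⟫ ≤ 0 := by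
      have hlim : Tendsto (fun k => -2 * (‖x k‖⁻¹ * ⟪ci i, ‖x k‖⁻¹ • x k⟫) +
          -2 * α i * (‖x k‖⁻¹ * ‖x k‖⁻¹)) atTop (𝓝 0) := by
        simpa using ((hinv.mul (hw (ci i))).const_mul (-2)).add
          ((hinv.mul hinv).const_mul (-2 * α i))
      refine le_of_tendsto_of_tendsto' (((hw (Ti i v₀)).const_mul 2).sub_const _) hlim fun k => ?_
      have hpos := hTi_pos i (‖x k‖⁻¹ • x k - v₀)
      simp only [map_sub, map_smul, inner_sub_left, inner_sub_right, real_inner_smul_left,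
        real_inner_smul_right, ← hTi_sa i v₀ (x k), real_inner_comm (Ti i v₀) (x k)] at hpos ⊢
      nlinarith [mul_le_mul_of_nonneg_left (hg k) (mul_self_nonneg ‖x k‖⁻¹)]
    rw [hTi_sa] at hq
    exact ⟨apply_eq_zero_of_inner_self_apply_eq_zero (Ti i) (hTi_sa i) (hTi_pos i)
      (le_antisymm (by linarith) (hTi_pos i v₀)), hc⟩
  refine ⟨fun y hy t ht => ?_, key⟩
  rw [hF] at hy ⊢
  intro i
  obtain ⟨hT, hc⟩ := key i
  have hy' := hy i
  have hyv : ⟪v₀, Ti i y⟫ = 0 := by rw [← hTi_sa, hT, inner_zero_left]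
  simp only [map_add, map_smul, hT, smul_zero, add_zero, inner_add_left, inner_add_right,
    real_inner_smul_left, real_inner_smul_right, hyv, mul_zero]
  linarith [mul_nonpos_of_nonneg_of_nonpos ht hc]
end

section
/- Let a_k be a sequence of real numbers and S_k = {x ∈ F : f(x) ≤ a_k}. Suppose: (a) x ↦ ⟨x, T x⟩ is weakly sequentially lower semicontinuous; (b) x^k is a nonzero element of minimal norm in S_k for each k; (c) x^k/‖x^k‖ converges weakly to some nonzero v̄ with ⟨v̄, T v̄⟩ = 0 and ⟨T x^k + c, v̄⟩ ≥ 0 for all k; (d) condition (A) holds. Then the sequence x^k is bounded. -/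
open scoped RealInnerProductSpace
open Filter Topology

section
variable {H ι : Type*} [NormedAddCommGroup H] [InnerProductSpace ℝ H]

/-- A positive semidefinite self-adjoint operator vanishes where its quadratic form does. -/
theorem apply_eq_zero_of_inner_self_nonpos (A : H →L[ℝ] H)
    (hsa : ∀ x y : H, ⟪A x, y⟫ = ⟪x, A y⟫) (hpos : ∀ x : H, 0 ≤ ⟪x, A x⟫)
    {v : H} (hv : ⟪v, A v⟫ ≤ 0) : A v = 0 := by
  have hv0 : ⟪v, A v⟫ = 0 := le_antisymm hv (hpos v)
  have key : ∀ s : ℝ, 0 ≤ ⟪A v, A (A v)⟫ * (s * s) + (2 * ⟪A v, A v⟫) * s + 0 := by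
    intro s
    have h := hpos (v + s • A v)
    simp only [map_add, map_smul, inner_add_left, inner_add_right, real_inner_smul_left,
      real_inner_smul_right, hv0, ← hsa v (A v)] at h
    linarith
  have hd := discrim_le_zero key
  rw [discrim] at hd
  have h0 : ⟪A v, A v⟫ = 0 := by nlinarith [sq_nonneg ⟪A v, A v⟫]
  exact inner_self_eq_zero.mp h0

/-- The quadratic form of a positive semidefinite operator is weakly sequentially lower
semicontinuous: any limit bound along a weakly convergent family passes to the weak limit. -/
theorem inner_self_le_of_tendsto_inner {l : Filter ι} [l.NeBot] (A : H →L[ℝ] H)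
    (hsa : ∀ x y : H, ⟪A x, y⟫ = ⟪x, A y⟫) (hpos : ∀ x : H, 0 ≤ ⟪x, A x⟫)
    {u : ι → H} {v : H} (hu : ∀ a : H, Tendsto (fun k => ⟪a, u k⟫) l (𝓝 ⟪a, v⟫))
    {b : ι → ℝ} {B : ℝ} (hb : Tendsto b l (𝓝 B)) (hub : ∀ k, ⟪u k, A (u k)⟫ ≤ b k) :
    ⟪v, A v⟫ ≤ B := by
  have hlim : Tendsto (fun k => 2 * ⟪A v, u k⟫ - ⟪v, A v⟫) l
      (𝓝 (2 * ⟪A v, v⟫ - ⟪v, A v⟫)) := ((hu (A v)).const_mul 2).sub_const _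
  have hle := le_of_tendsto_of_tendsto' hlim hb fun k => by
    have h := hpos (u k - v)
    simp only [map_sub, inner_sub_left, inner_sub_right] at h
    have h1 : ⟪u k, A v⟫ = ⟪A v, u k⟫ := real_inner_comm _ _
    have h2 : ⟪v, A (u k)⟫ = ⟪A v, u k⟫ := (hsa _ _).symm
    have h3 := hub k
    linarith
  rw [hsa] at hle
  linarith

/-- If points in a convex quadratic sublevel set go to infinity in the weak direction `v`, then
`v` lies in the kernel of the quadratic part and the linear part is nonpositive at `v`. -/
theorem quadratic_asymptotic_direction {l : Filter ι} [l.NeBot] (A : H →L[ℝ] H)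
    (hsa : ∀ x y : H, ⟪A x, y⟫ = ⟪x, A y⟫) (hpos : ∀ x : H, 0 ≤ ⟪x, A x⟫)
    (c : H) (α : ℝ) {x : ι → H} (hx0 : ∀ k, x k ≠ 0)
    (hx : ∀ k, (1/2 : ℝ) * ⟪x k, A (x k)⟫ + ⟪c, x k⟫ + α ≤ 0)
    (hnorm : Tendsto (fun k => ‖x k‖) l atTop) {v : H}
    (hw : ∀ a : H, Tendsto (fun k => ⟪a, ‖x k‖⁻¹ • x k⟫) l (𝓝 ⟪a, v⟫)) :
    A v = 0 ∧ ⟪c, v⟫ ≤ 0 := by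
  have hinv : Tendsto (fun k => ‖x k‖⁻¹) l (𝓝 0) := tendsto_inv_atTop_zero.comp hnorm
  have hipos : ∀ k, 0 < ‖x k‖⁻¹ := fun k => inv_pos.mpr (norm_pos_iff.mpr (hx0 k))
  constructor
  · refine apply_eq_zero_of_inner_self_nonpos A hsa hpos ?_
    have hb : Tendsto (fun k => -2 * (‖x k‖⁻¹ * (⟪c, ‖x k‖⁻¹ • x k⟫ + ‖x k‖⁻¹ * α))) l
        (𝓝 (-2 * (0 * (⟪c, v⟫ + 0 * α)))) :=
      (hinv.mul ((hw c).add (hinv.mul_const α))).const_mul _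
    refine (inner_self_le_of_tendsto_inner A hsa hpos hw hb fun k => ?_).trans (by simp)
    simp only [map_smul, real_inner_smul_left, real_inner_smul_right]
    have h := mul_nonpos_of_nonneg_of_nonpos (sq_nonneg ‖x k‖⁻¹) (hx k)
    linarith
  · have hb : Tendsto (fun k => -(‖x k‖⁻¹ * α)) l (𝓝 (-(0 * α))) := (hinv.mul_const α).neg
    refine (le_of_tendsto_of_tendsto' (hw c) hb fun k => ?_).trans (by simp)
    have h := mul_nonpos_of_nonneg_of_nonpos (hipos k).le (hx k)
    have h' := mul_nonneg (hipos k).le (hpos (x k))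
    rw [real_inner_smul_right]
    linarith

/-- Moving along a direction in the kernel of the quadratic part changes a quadratic function
linearly. -/
theorem quadratic_add_smul_of_apply_eq_zero (A : H →L[ℝ] H)
    (hsa : ∀ x y : H, ⟪A x, y⟫ = ⟪x, A y⟫) (c : H) {v : H} (hv : A v = 0) (y : H) (t : ℝ) :
    (1/2 : ℝ) * ⟪y + t • v, A (y + t • v)⟫ + ⟪c, y + t • v⟫
      = (1/2 : ℝ) * ⟪y, A y⟫ + ⟪c, y⟫ + t * ⟪c, v⟫ := by
  have h : ⟪v, A y⟫ = 0 := by rw [← hsa, hv, inner_zero_left]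
  simp only [map_add, map_smul, hv, smul_zero, add_zero, inner_add_left, inner_add_right,
    real_inner_smul_left, real_inner_smul_right, h]
  ring

/-- If `x k` goes to infinity in the weak direction `v`, then `⟪a, x k⟫ → ∞` for every `a` with
`⟪a, v⟫ > 0`. -/
theorem tendsto_inner_atTop_of_tendsto_inner_normalized {l : Filter ι} {x : ι → H}
    (hx0 : ∀ k, x k ≠ 0) (hnorm : Tendsto (fun k => ‖x k‖) l atTop) {v a : H}
    (hw : Tendsto (fun k => ⟪a, ‖x k‖⁻¹ • x k⟫) l (𝓝 ⟪a, v⟫)) (ha : 0 < ⟪a, v⟫) :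
    Tendsto (fun k => ⟪a, x k⟫) l atTop := by
  refine (hnorm.atTop_mul_pos ha hw).congr fun k => ?_
  rw [real_inner_smul_right, mul_inv_cancel_left₀ (norm_ne_zero_iff.mpr (hx0 k))]

/-- Along an unbounded sequence, the index tends to infinity as the norm does. -/
theorem comap_norm_atTop_le_atTop {E : Type*} [NormedAddCommGroup E] (x : ℕ → E) : comap (fun k => ‖x k‖) atTop ≤ atTop := by
  rw [← Nat.cofinite_eq_atTop, le_cofinite_iff_eventually_ne]
  intro n
  filter_upwards [tendsto_comap.eventually (eventually_gt_atTop ‖x n‖)] with k hk hkn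
  exact lt_irrefl _ (hkn ▸ hk)

end

/-- Boundedness lemma: under weak sequential lower semicontinuity of the quadratic form,
minimal-norm elements `x k` of the sublevel sets `S k`, weak convergence of the normalized
sequence to a nonzero `v₀` with `⟪v₀, T v₀⟫ = 0` and `⟪T (x k) + c, v₀⟫ ≥ 0`, and
condition (A), the sequence `x k` is bounded. -/
theorem minimal_norm_sequence_bounded
    {H : Type*} [NormedAddCommGroup H] [InnerProductSpace ℝ H] [CompleteSpace H]
    {m : ℕ} (T : H →L[ℝ] H) (hT_sa : ∀ x y : H, ⟪T x, y⟫ = ⟪x, T y⟫) (c : H)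
    (Ti : Fin m → H →L[ℝ] H)
    (hTi_sa : ∀ i, ∀ x y : H, ⟪Ti i x, y⟫ = ⟪x, Ti i y⟫)
    (hTi_pos : ∀ i, ∀ x : H, 0 ≤ ⟪x, Ti i x⟫)
    (ci : Fin m → H) (α : Fin m → ℝ)
    (f : H → ℝ) (hf : ∀ x, f x = (1/2 : ℝ) * ⟪x, T x⟫ + ⟪c, x⟫)
    (F : Set H)
    (hF : F = {x : H | ∀ i, (1/2 : ℝ) * ⟪x, Ti i x⟫ + ⟪ci i, x⟫ + α i ≤ 0})
    (hwlsc : ∀ (x : ℕ → H) (x₀ : H), WeaklyConvergesTo x x₀ →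
      ⟪x₀, T x₀⟫ ≤ Filter.liminf (fun k => ⟪x k, T (x k)⟫) Filter.atTop)
    (a : ℕ → ℝ) (S : ℕ → Set H) (hS : ∀ k, S k = {x ∈ F | f x ≤ a k})
    (x : ℕ → H) (hx0 : ∀ k, x k ≠ 0)
    (hmem : ∀ k, x k ∈ S k) (hmin : ∀ k, ∀ y ∈ S k, ‖x k‖ ≤ ‖y‖)
    (v₀ : H) (hv₀ : v₀ ≠ 0)
    (hw : WeaklyConvergesTo (fun k => ‖x k‖⁻¹ • x k) v₀)
    (hq : ⟪v₀, T v₀⟫ = 0) (hTx : ∀ k, 0 ≤ ⟪T (x k) + c, v₀⟫)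
    (hA : ∀ v ∈ recessionCone F, ⟪v, T v⟫ = 0 → ∀ i, Ti i ≠ 0 → ⟪ci i, v⟫ = 0)
    :
    ∃ M : ℝ, ∀ k, ‖x k‖ ≤ M := by
  by_contra! hunb
  let l : Filter ℕ := comap (fun k => ‖x k‖) atTop
  have hnorm : Tendsto (fun k => ‖x k‖) l atTop := tendsto_comap
  have hl : l.NeBot := by
    refine comap_neBot fun s hs => ?_
    obtain ⟨M, hM⟩ := mem_atTop_sets.mp hs
    obtain ⟨k, hk⟩ := hunb M
    exact ⟨k, hM _ hk.le⟩
  have hwl : ∀ a : H, Tendsto (fun k => ⟪a, ‖x k‖⁻¹ • x k⟫) l (𝓝 ⟪a, v₀⟫) :=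
    fun a => (hw a).mono_left (comap_norm_atTop_le_atTop x)
  have hxS : ∀ k, x k ∈ F ∧ f (x k) ≤ a k := fun k => by simpa [hS k] using hmem k
  have hxF : ∀ k i, (1/2 : ℝ) * ⟪x k, Ti i (x k)⟫ + ⟪ci i, x k⟫ + α i ≤ 0 := fun k => by
    have h := (hxS k).1
    rwa [hF] at h
  have hdir : ∀ i, Ti i v₀ = 0 ∧ ⟪ci i, v₀⟫ ≤ 0 := fun i =>
    quadratic_asymptotic_direction (Ti i) (hTi_sa i) (hTi_pos i) (ci i) (α i) hx0
      (fun k => hxF k i) hnorm hwl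
  have hrec : v₀ ∈ recessionCone F := by
    intro y hy t ht
    rw [hF] at hy ⊢
    intro i
    rw [quadratic_add_smul_of_apply_eq_zero (Ti i) (hTi_sa i) (ci i) (hdir i).1]
    linarith [hy i, mul_nonpos_of_nonneg_of_nonpos ht (hdir i).2]
  have hfeas : ∀ i, ∀ᶠ k in l, (1/2 : ℝ) * ⟪x k + (-1 : ℝ) • v₀, Ti i (x k + (-1 : ℝ) • v₀)⟫
      + ⟪ci i, x k + (-1 : ℝ) • v₀⟫ + α i ≤ 0 := by
    intro i
    simp only [quadratic_add_smul_of_apply_eq_zero (Ti i) (hTi_sa i) (ci i) (hdir i).1]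
    rcases (hdir i).2.eq_or_lt with h0 | hneg
    · exact Eventually.of_forall fun k => by linarith [hxF k i]
    · have hTi0 : Ti i = 0 := by
        by_contra hne
        exact hneg.ne (hA v₀ hrec hq i hne)
      have hlim := tendsto_inner_atTop_of_tendsto_inner_normalized hx0 hnorm (hwl (-ci i))
        (by rw [inner_neg_left]; linarith)
      filter_upwards [hlim.eventually_ge_atTop (α i - ⟪ci i, v₀⟫)] with k hk
      rw [inner_neg_left] at hk
      simp only [hTi0, zero_apply, inner_zero_right]
      linarith
  have hlim := tendsto_inner_atTop_of_tendsto_inner_normalized hx0 hnorm (hwl v₀)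
    (real_inner_self_pos.mpr hv₀)
  obtain ⟨k, hkF, hk⟩ :=
    ((eventually_all.mpr hfeas).and (hlim.eventually_gt_atTop (‖v₀‖ ^ 2))).exists
  have hfk : f (x k + (-1 : ℝ) • v₀) ≤ a k := by
    refine le_trans ?_ (hxS k).2
    have h := hTx k
    rw [inner_add_left] at h
    have h1 : ⟪x k, T v₀⟫ = ⟪T (x k), v₀⟫ := (hT_sa _ _).symm
    have h2 : ⟪v₀, T (x k)⟫ = ⟪T (x k), v₀⟫ := real_inner_comm _ _
    simp only [hf, map_add, map_smul, inner_add_left, inner_add_right, real_inner_smul_left,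
      real_inner_smul_right, hq, h1, h2]
    linarith
  have hle := hmin k (x k + (-1 : ℝ) • v₀) (by rw [hS k, hF]; exact ⟨hkF, hfk⟩)
  have hsq := pow_le_pow_left₀ (norm_nonneg _) hle 2
  rw [neg_one_smul, ← sub_eq_add_neg, norm_sub_sq_real, real_inner_comm] at hsq
  have hv := sq_nonneg ‖v₀‖
  linarith
end

section
/- (Frank–Wolfe-type theorem 1) Suppose the quadratic form x ↦ ⟨x, T x⟩ is a Legendre form, the constraint set F is nonempty, f is bounded from below on F, and condition (A) is satisfied. Then f attains its infimum on F, i.e., there exists x̄ ∈ F with f(x̄) ≤ f(x) for all x ∈ F. -/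
open scoped RealInnerProductSpace
open Filter Topology

/-- The quadratic form `x ↦ ⟪x, T x⟫` is a Legendre form: it is weakly sequentially lower
semicontinuous, and `x k → x₀` strongly whenever `x k ⇀ x₀` and `⟪x k, T (x k)⟫ → ⟪x₀, T x₀⟫`. -/
def IsLegendreForm {H : Type*} [NormedAddCommGroup H] [InnerProductSpace ℝ H]
    (T : H →L[ℝ] H) : Prop :=
  (∀ (x : ℕ → H) (x₀ : H), WeaklyConvergesTo x x₀ →
      ⟪x₀, T x₀⟫ ≤ Filter.liminf (fun k => ⟪x k, T (x k)⟫) Filter.atTop) ∧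
  (∀ (x : ℕ → H) (x₀ : H), WeaklyConvergesTo x x₀ →
      Tendsto (fun k => ⟪x k, T (x k)⟫) atTop (𝓝 ⟪x₀, T x₀⟫) →
      Tendsto x atTop (𝓝 x₀))

section RealPolynomials

theorem quadraticCoeff_nonneg_of_bddBelow {L a b d : ℝ}
    (h : ∀ t : ℝ, 0 ≤ t → L ≤ a + t * b + t ^ 2 * d) : 0 ≤ d := by
  by_contra! hd
  have hnd : 0 < -d := by linarith
  set s : ℝ := (|a - L| + |b|) / (-d) with hs
  have hs0 : 0 ≤ s := by positivity
  have hsd : s * d = -(|a - L| + |b|) := by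
    rw [hs, div_mul_eq_mul_div, div_eq_iff hnd.ne']
    ring
  have key := h (s + 1) (by linarith)
  have h1 : |a - L| ≤ (s + 1) * |a - L| := by nlinarith [abs_nonneg (a - L)]
  have h2 : (s + 1) * b ≤ (s + 1) * |b| :=
    mul_le_mul_of_nonneg_left (le_abs_self b) (by linarith)
  have h3 : (s + 1) ^ 2 * d = (s + 1) * (-(|a - L| + |b|)) + (s + 1) * d := by
    rw [← hsd]; ring
  have h4 : (s + 1) * d < 0 := mul_neg_of_pos_of_neg (by linarith) hd
  nlinarith [le_abs_self (a - L)]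

theorem linearCoeff_nonneg_of_bddBelow {L a b : ℝ}
    (h : ∀ t : ℝ, 0 ≤ t → L ≤ a + t * b) : 0 ≤ b := by
  by_contra! hb
  have hnb : 0 < -b := by linarith
  have key := h ((|a - L| + 1) / (-b)) (by positivity)
  have : (|a - L| + 1) / (-b) * b = -(|a - L| + 1) := by
    rw [div_mul_eq_mul_div, div_eq_iff hnb.ne']
    ring
  linarith [le_abs_self (a - L)]

end RealPolynomials

section HilbertSpace

variable {H : Type*} [NormedAddCommGroup H] [InnerProductSpace ℝ H]

theorem WeaklyConvergesTo.comp {x : ℕ → H} {x₀ : H} (h : WeaklyConvergesTo x x₀) {φ : ℕ → ℕ}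
    (hφ : StrictMono φ) : WeaklyConvergesTo (x ∘ φ) x₀ :=
  fun a => (h a).comp hφ.tendsto_atTop

theorem WeaklyConvergesTo.norm_le {x : ℕ → H} {x₀ : H} (h : WeaklyConvergesTo x x₀) {r : ℝ}
    (hr : Tendsto (fun k => ‖x k‖) atTop (𝓝 r)) : ‖x₀‖ ≤ r := by
  have h1 : ⟪x₀, x₀⟫ ≤ ‖x₀‖ * r :=
    le_of_tendsto_of_tendsto' (h x₀) (hr.const_mul _) fun k => real_inner_le_norm _ _
  rw [real_inner_self_eq_norm_mul_norm] at h1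
  rcases (norm_nonneg x₀).eq_or_lt with h0 | h0
  · rw [← h0]
    exact ge_of_tendsto' hr fun k => norm_nonneg _
  · exact le_of_mul_le_mul_left h1 h0

/-- Bounded sequences in a Hilbert space have weakly convergent subsequences. -/
theorem exists_subseq_weaklyConvergesTo [CompleteSpace H] {x : ℕ → H} {C : ℝ}
    (hx : ∀ k, ‖x k‖ ≤ C) :
    ∃ (x₀ : H) (φ : ℕ → ℕ), StrictMono φ ∧ WeaklyConvergesTo (x ∘ φ) x₀ := by
  set K : Submodule ℝ H := (Submodule.span ℝ (Set.range x)).topologicalClosure with hK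
  have hxK : ∀ k, x k ∈ K := fun k =>
    Submodule.le_topologicalClosure _ (Submodule.subset_span (Set.mem_range_self k))
  have hsep : TopologicalSpace.IsSeparable (K : Set H) := by
    rw [hK, Submodule.topologicalClosure_coe]
    exact ((Set.countable_range x).isSeparable.span (R := ℝ)).closure
  have : TopologicalSpace.SeparableSpace K := hsep.separableSpace
  have : CompleteSpace K :=
    (Submodule.isClosed_topologicalClosure _).completeSpace_coe
  let y : ℕ → K := fun k => ⟨x k, hxK k⟩
  let ℓ : ℕ → WeakDual ℝ K := fun k =>
    StrongDual.toWeakDual (InnerProductSpace.toDual ℝ K (y k))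
  have hℓ : ∀ k, ℓ k ∈ WeakDual.toStrongDual ⁻¹' Metric.closedBall (0 : StrongDual ℝ K) C := by
    intro k
    rw [Set.mem_preimage]
    refine (mem_closedBall_zero_iff (E := StrongDual ℝ K)).2 ?_
    exact ((InnerProductSpace.toDual ℝ K).norm_map (y k)).trans_le (hx k)
  obtain ⟨ℓ₀, -, φ, hφ, hlim⟩ := WeakDual.isSeqCompact_closedBall ℝ K 0 C hℓ
  set y₀ : K := (InnerProductSpace.toDual ℝ K).symm (WeakDual.toStrongDual ℓ₀) with hy₀
  refine ⟨y₀, φ, hφ, fun a => ?_⟩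
  have hp : ∀ z : K, ⟪a, (z : H)⟫ = ⟪z, K.orthogonalProjectionOnto a⟫ := by
    intro z
    rw [real_inner_comm, ← Submodule.inner_orthogonalProjectionOnto_eq_of_mem_left]
  have := ((WeakDual.eval_continuous (𝕜 := ℝ) (K.orthogonalProjectionOnto a)).tendsto ℓ₀).comp hlim
  have h0 : ℓ₀ (K.orthogonalProjectionOnto a) = ⟪a, (y₀ : H)⟫ := by
    rw [hp, hy₀, InnerProductSpace.toDual_symm_apply]
    rfl
  simp only [h0] at this
  refine this.congr fun k => ?_
  exact (hp (y (φ k))).symm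

/-- The quadratic function `x ↦ ½⟪x, T x⟫ + ⟪c, x⟫`. -/
noncomputable def quadraticFunction (T : H →L[ℝ] H) (c x : H) : ℝ :=
  (1 / 2 : ℝ) * ⟪x, T x⟫ + ⟪c, x⟫

theorem inner_apply_add_smul {T : H →L[ℝ] H} (hT : ∀ x y : H, ⟪T x, y⟫ = ⟪x, T y⟫)
    (x v : H) (t : ℝ) :
    ⟪x + t • v, T (x + t • v)⟫ = ⟪x, T x⟫ + t * (2 * ⟪v, T x⟫) + t ^ 2 * ⟪v, T v⟫ := by
  have h : ⟪x, T v⟫ = ⟪v, T x⟫ := by rw [← hT, real_inner_comm]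
  simp only [map_add, map_smul, inner_add_left, inner_add_right, real_inner_smul_left,
    real_inner_smul_right, h]
  ring

theorem quadraticFunction_add_smul {T : H →L[ℝ] H} (hT : ∀ x y : H, ⟪T x, y⟫ = ⟪x, T y⟫)
    (c x v : H) (t : ℝ) :
    quadraticFunction T c (x + t • v) =
      quadraticFunction T c x + t * (⟪v, T x⟫ + ⟪c, v⟫) + t ^ 2 * ((1 / 2) * ⟪v, T v⟫) := by
  simp only [quadraticFunction, inner_apply_add_smul hT, inner_add_right, real_inner_smul_right]
  ring

theorem inner_apply_eq_zero_of_inner_self_eq_zero {T : H →L[ℝ] H}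
    (hT : ∀ x y : H, ⟪T x, y⟫ = ⟪x, T y⟫) (hpos : ∀ x : H, 0 ≤ ⟪x, T x⟫) {v : H}
    (hv : ⟪v, T v⟫ = 0) (w : H) : ⟪v, T w⟫ = 0 := by
  have key : ∀ u : H, ⟪u, T u⟫ = 0 → 0 ≤ ⟪u, T w⟫ := by
    intro u hu
    have : 0 ≤ 2 * ⟪u, T w⟫ := by
      refine linearCoeff_nonneg_of_bddBelow (L := 0) (a := ⟪w, T w⟫) fun t _ => ?_
      have := hpos (w + t • u)
      rw [inner_apply_add_smul hT, hu] at this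
      linarith
    linarith
  have h1 := key v hv
  have h2 := key (-v) (by simpa using hv)
  rw [inner_neg_left] at h2
  linarith

theorem WeaklyConvergesTo.quadraticFunction_le {T : H →L[ℝ] H}
    (hT : ∀ x y : H, ⟪T x, y⟫ = ⟪x, T y⟫) (hpos : ∀ x : H, 0 ≤ ⟪x, T x⟫) {c : H}
    {x : ℕ → H} {x₀ : H} (h : WeaklyConvergesTo x x₀) {b : ℝ}
    (hb : ∀ᶠ k in atTop, quadraticFunction T c (x k) ≤ b) : quadraticFunction T c x₀ ≤ b := by
  have hlim : Tendsto (fun k => ⟪T x₀, x k⟫ - (1 / 2) * ⟪x₀, T x₀⟫ + ⟪c, x k⟫) atTop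
      (𝓝 (⟪T x₀, x₀⟫ - (1 / 2) * ⟪x₀, T x₀⟫ + ⟪c, x₀⟫)) :=
    ((h (T x₀)).sub_const _).add (h c)
  have hle : ⟪T x₀, x₀⟫ - (1 / 2) * ⟪x₀, T x₀⟫ + ⟪c, x₀⟫ ≤ b := by
    refine le_of_tendsto hlim (hb.mono fun k hk => ?_)
    have h1 := hpos (x k + (-1 : ℝ) • x₀)
    rw [inner_apply_add_smul hT, ← hT x₀ (x k)] at h1
    unfold quadraticFunction at hk
    linarith
  rw [hT] at hle
  unfold quadraticFunction
  linarith

theorem quadraticFunction_segment_le {T : H →L[ℝ] H}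
    (hT : ∀ x y : H, ⟪T x, y⟫ = ⟪x, T y⟫) (hpos : ∀ x : H, 0 ≤ ⟪x, T x⟫) {c x y : H} {b s : ℝ}
    (hx : quadraticFunction T c x ≤ b) (hy : quadraticFunction T c y ≤ b)
    (hs0 : 0 ≤ s) (hs1 : s ≤ 1) : quadraticFunction T c (y + s • (x - y)) ≤ b := by
  have hx' : quadraticFunction T c (y + (1 : ℝ) • (x - y)) ≤ b := by simpa using hx
  have hp := hpos (x - y)
  rw [quadraticFunction_add_smul hT] at hx' ⊢
  nlinarith [mul_nonneg (mul_nonneg hs0 (sub_nonneg.2 hs1)) hp,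
    mul_le_mul_of_nonneg_left hx' hs0, mul_le_mul_of_nonneg_left hy (sub_nonneg.2 hs1)]

section FeasibleSet

variable {m : ℕ} {Ti : Fin m → H →L[ℝ] H} {ci : Fin m → H} {β : Fin m → ℝ}

/-- The set cut out by the convex quadratic inequalities `½⟪x, Tᵢ x⟫ + ⟪cᵢ, x⟫ ≤ βᵢ`. -/
def quadraticFeasibleSet (Ti : Fin m → H →L[ℝ] H) (ci : Fin m → H) (β : Fin m → ℝ) : Set H :=
  {x | ∀ i, quadraticFunction (Ti i) (ci i) x ≤ β i}

theorem WeaklyConvergesTo.mem_quadraticFeasibleSet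
    (hsa : ∀ i, ∀ x y : H, ⟪Ti i x, y⟫ = ⟪x, Ti i y⟫) (hpos : ∀ i, ∀ x : H, 0 ≤ ⟪x, Ti i x⟫)
    {x : ℕ → H} {x₀ : H} (h : WeaklyConvergesTo x x₀)
    (hx : ∀ᶠ k in atTop, x k ∈ quadraticFeasibleSet Ti ci β) :
    x₀ ∈ quadraticFeasibleSet Ti ci β :=
  fun i => h.quadraticFunction_le (hsa i) (hpos i) (hx.mono fun _ hk => hk i)

theorem mem_recessionCone_of_weaklyConvergesTo_normalized
    (hsa : ∀ i, ∀ x y : H, ⟪Ti i x, y⟫ = ⟪x, Ti i y⟫) (hpos : ∀ i, ∀ x : H, 0 ≤ ⟪x, Ti i x⟫)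
    {x : ℕ → H} {v : H} (hx : ∀ k, x k ∈ quadraticFeasibleSet Ti ci β)
    (hnorm : Tendsto (fun k => ‖x k‖) atTop atTop)
    (hv : WeaklyConvergesTo (fun k => ‖x k‖⁻¹ • x k) v) :
    v ∈ recessionCone (quadraticFeasibleSet Ti ci β) := by
  intro y hy t ht
  have hlim : WeaklyConvergesTo (fun k => y + (t * ‖x k‖⁻¹) • (x k - y)) (y + t • v) := by
    intro a
    have h1 : Tendsto (fun k => ⟪a, y⟫ + t * (⟪a, ‖x k‖⁻¹ • x k⟫ - ‖x k‖⁻¹ * ⟪a, y⟫)) atTop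
        (𝓝 (⟪a, y⟫ + t * (⟪a, v⟫ - 0 * ⟪a, y⟫))) :=
      (((hv a).sub (hnorm.inv_tendsto_atTop.mul_const _)).const_mul t).const_add _
    convert h1 using 2
    · simp only [inner_add_right, inner_sub_right, real_inner_smul_right]
      ring
    · simp only [inner_add_right, real_inner_smul_right]
      ring
  refine hlim.mem_quadraticFeasibleSet hsa hpos ?_
  filter_upwards [hnorm.eventually_ge_atTop t, hnorm.eventually_gt_atTop 0] with k hk hk0 i
  refine quadraticFunction_segment_le (hsa i) (hpos i) (hx k i) (hy i) (by positivity) ?_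
  rw [← div_eq_mul_inv]
  exact (div_le_one hk0).2 hk

theorem inner_self_eq_zero_and_inner_nonpos_of_mem_recessionCone
    (hsa : ∀ i, ∀ x y : H, ⟪Ti i x, y⟫ = ⟪x, Ti i y⟫) (hpos : ∀ i, ∀ x : H, 0 ≤ ⟪x, Ti i x⟫)
    (hne : (quadraticFeasibleSet Ti ci β).Nonempty) {v : H}
    (hv : v ∈ recessionCone (quadraticFeasibleSet Ti ci β)) (i : Fin m) :
    ⟪v, Ti i v⟫ = 0 ∧ ⟪ci i, v⟫ ≤ 0 := by
  obtain ⟨y, hy⟩ := hne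
  have hray : ∀ t : ℝ, 0 ≤ t → quadraticFunction (Ti i) (ci i) (y + t • v) ≤ β i :=
    fun t ht => hv y hy t ht i
  simp only [quadraticFunction_add_smul (hsa i)] at hray
  have h0 : ⟪v, Ti i v⟫ = 0 := by
    have := quadraticCoeff_nonneg_of_bddBelow (L := -β i)
      (a := -quadraticFunction (Ti i) (ci i) y) (b := -(⟪v, Ti i y⟫ + ⟪ci i, v⟫))
      (d := -(1 / 2 * ⟪v, Ti i v⟫)) fun t ht => by linarith [hray t ht]
    linarith [hpos i v]
  refine ⟨h0, ?_⟩
  have := linearCoeff_nonneg_of_bddBelow (L := -β i)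
    (a := -quadraticFunction (Ti i) (ci i) y) (b := -⟪ci i, v⟫) fun t ht => by
      have := hray t ht
      rw [h0, inner_apply_eq_zero_of_inner_self_eq_zero (hsa i) (hpos i) h0] at this
      linarith
  linarith

theorem eventually_add_neg_smul_mem_quadraticFeasibleSet
    (hsa : ∀ i, ∀ x y : H, ⟪Ti i x, y⟫ = ⟪x, Ti i y⟫) (hpos : ∀ i, ∀ x : H, 0 ≤ ⟪x, Ti i x⟫)
    {x : ℕ → H} {v : H} (hx : ∀ k, x k ∈ quadraticFeasibleSet Ti ci β)
    (hnorm : Tendsto (fun k => ‖x k‖) atTop atTop)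
    (hv : WeaklyConvergesTo (fun k => ‖x k‖⁻¹ • x k) v)
    (hzero : ∀ i, Ti i ≠ 0 → ⟪ci i, v⟫ = 0) :
    ∀ᶠ k in atTop, x k + (-1 : ℝ) • v ∈ quadraticFeasibleSet Ti ci β := by
  have hcone := mem_recessionCone_of_weaklyConvergesTo_normalized hsa hpos hx hnorm hv
  refine eventually_all.2 fun i => ?_
  obtain ⟨h0, hle⟩ :=
    inner_self_eq_zero_and_inner_nonpos_of_mem_recessionCone hsa hpos ⟨x 0, hx 0⟩ hcone i
  simp only [quadraticFunction_add_smul (hsa i), h0,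
    inner_apply_eq_zero_of_inner_self_eq_zero (hsa i) (hpos i) h0]
  rcases hle.eq_or_lt with heq | hlt
  · refine Eventually.of_forall fun k => ?_
    rw [heq]
    linarith [hx k i]
  · have hTi : Ti i = 0 := by
      by_contra h
      exact hlt.ne (hzero i h)
    have hbot := hnorm.atTop_mul_neg hlt (hv (ci i))
    filter_upwards [hbot.eventually_le_atBot (β i + ⟪ci i, v⟫), hnorm.eventually_gt_atTop 0]
      with k hk hk0
    rw [real_inner_smul_right, mul_inv_cancel_left₀ hk0.ne'] at hk
    have hq : quadraticFunction (Ti i) (ci i) (x k) = ⟪ci i, x k⟫ := by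
      simp [quadraticFunction, hTi]
    rw [hq]
    linarith

end FeasibleSet

section Minimization

theorem IsLegendreForm.inner_le_of_tendsto {T : H →L[ℝ] H} (hT : IsLegendreForm T)
    {x : ℕ → H} {x₀ : H} (h : WeaklyConvergesTo x x₀) {q : ℝ}
    (hq : Tendsto (fun k => ⟪x k, T (x k)⟫) atTop (𝓝 q)) : ⟪x₀, T x₀⟫ ≤ q :=
  (hT.1 x x₀ h).trans_eq hq.liminf_eq

theorem abs_inner_apply_le (T : H →L[ℝ] H) {x : H} {C : ℝ} (hx : ‖x‖ ≤ C) :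
    |⟪x, T x⟫| ≤ C * (‖T‖ * C) := by
  have hC : 0 ≤ C := (norm_nonneg x).trans hx
  refine (abs_real_inner_le_norm _ _).trans ?_
  refine mul_le_mul hx ((T.le_opNorm x).trans ?_) (norm_nonneg _) hC
  gcongr

/-- A bounded sequence has a weakly convergent subsequence along which the norm and the quadratic
function converge, to limits no smaller than their values at the weak limit. -/
theorem IsLegendreForm.exists_subseq [CompleteSpace H] {T : H →L[ℝ] H} (hT : IsLegendreForm T)
    (c : H) {x : ℕ → H} {C : ℝ} (hx : ∀ k, ‖x k‖ ≤ C) :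
    ∃ (x₀ : H) (φ : ℕ → ℕ) (r q : ℝ), StrictMono φ ∧ WeaklyConvergesTo (x ∘ φ) x₀ ∧
      Tendsto (fun k => ‖x (φ k)‖) atTop (𝓝 r) ∧
      Tendsto (fun k => quadraticFunction T c (x (φ k))) atTop (𝓝 q) ∧
      ‖x₀‖ ≤ r ∧ quadraticFunction T c x₀ ≤ q := by
  obtain ⟨x₀, φ, hφ, hw⟩ := exists_subseq_weaklyConvergesTo hx
  obtain ⟨r, -, ψ, hψ, hr⟩ := tendsto_subseq_of_bounded (Metric.isBounded_Icc 0 C)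
    (x := fun k => ‖x (φ k)‖) fun k => ⟨norm_nonneg _, hx _⟩
  obtain ⟨q, -, χ, hχ, hq⟩ := tendsto_subseq_of_bounded
    (Metric.isBounded_Icc (-(C * (‖T‖ * C))) (C * (‖T‖ * C)))
    (x := fun k => ⟪x (φ (ψ k)), T (x (φ (ψ k)))⟫)
    fun k => abs_le.1 (abs_inner_apply_le T (hx _))
  have hw' : WeaklyConvergesTo (x ∘ (φ ∘ ψ ∘ χ)) x₀ := (hw.comp hψ).comp hχ
  have hr' : Tendsto (fun k => ‖x ((φ ∘ ψ ∘ χ) k)‖) atTop (𝓝 r) := hr.comp hχ.tendsto_atTop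
  refine ⟨x₀, φ ∘ ψ ∘ χ, r, (1 / 2) * q + ⟪c, x₀⟫, hφ.comp (hψ.comp hχ), hw', hr',
    (hq.const_mul _).add (hw' c), hw'.norm_le hr', ?_⟩
  have := hT.inner_le_of_tendsto hw' hq
  unfold quadraticFunction
  linarith

theorem IsLegendreForm.exists_isMinOn_add_sq_norm [CompleteSpace H] {T : H →L[ℝ] H}
    (hT : IsLegendreForm T) {c : H} {F : Set H} (hne : F.Nonempty)
    (hF : ∀ (x : ℕ → H) (x₀ : H), WeaklyConvergesTo x x₀ → (∀ k, x k ∈ F) → x₀ ∈ F)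
    {L : ℝ} (hL : ∀ x ∈ F, L ≤ quadraticFunction T c x) {ε : ℝ} (hε : 0 < ε) :
    ∃ x ∈ F, ∀ y ∈ F,
      quadraticFunction T c x + ε * ‖x‖ ^ 2 ≤ quadraticFunction T c y + ε * ‖y‖ ^ 2 := by
  set g : H → ℝ := fun x => quadraticFunction T c x + ε * ‖x‖ ^ 2 with hg
  have hbdd : BddBelow (g '' F) := by
    refine ⟨L, ?_⟩
    rintro _ ⟨x, hx, rfl⟩
    have : 0 ≤ ε * ‖x‖ ^ 2 := by positivity
    linarith [hL x hx]
  obtain ⟨u, -, hu, huF⟩ := exists_seq_tendsto_sInf (hne.image g) hbdd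
  choose x hxF hxu using huF
  obtain ⟨M, hM⟩ := hu.bddAbove_range
  have hx : ∀ k, ‖x k‖ ≤ √((M - L) / ε) := by
    intro k
    refine Real.le_sqrt_of_sq_le ((le_div_iff₀ hε).2 ?_)
    have h1 : g (x k) ≤ M := (hxu k).trans_le (hM ⟨k, rfl⟩)
    have h2 := hL (x k) (hxF k)
    simp only [hg] at h1
    linarith
  obtain ⟨x₀, φ, r, q, hφ, hw, hr, hq, hxr, hxq⟩ := hT.exists_subseq c hx
  refine ⟨x₀, hF _ _ hw fun k => hxF _, fun y hy => ?_⟩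
  have hlim : Tendsto (fun k => g (x (φ k))) atTop (𝓝 (q + ε * r ^ 2)) :=
    hq.add ((hr.pow 2).const_mul ε)
  have hval : q + ε * r ^ 2 = sInf (g '' F) := by
    refine tendsto_nhds_unique hlim ?_
    simp only [hxu]
    exact hu.comp hφ.tendsto_atTop
  have hy' : sInf (g '' F) ≤ g y := csInf_le hbdd ⟨y, hy, rfl⟩
  have hsq : ε * ‖x₀‖ ^ 2 ≤ ε * r ^ 2 := by gcongr
  simp only [hg] at hy' hval
  linarith

theorem IsLegendreForm.exists_isMinOn_of_frequently_norm_lt [CompleteSpace H] {T : H →L[ℝ] H}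
    (hT : IsLegendreForm T) {c : H} {F : Set H}
    (hF : ∀ (x : ℕ → H) (x₀ : H), WeaklyConvergesTo x x₀ → (∀ k, x k ∈ F) → x₀ ∈ F)
    {x : ℕ → H} (hxF : ∀ k, x k ∈ F) {ε : ℕ → ℝ} (hε : Tendsto ε atTop (𝓝 0))
    (hmin : ∀ k, ∀ y ∈ F,
      quadraticFunction T c (x k) ≤ quadraticFunction T c y + ε k * ‖y‖ ^ 2)
    {C : ℝ} (hC : ∃ᶠ k in atTop, ‖x k‖ < C) :
    ∃ x₀ ∈ F, ∀ y ∈ F, quadraticFunction T c x₀ ≤ quadraticFunction T c y := by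
  obtain ⟨ψ, hψ, hψC⟩ := extraction_of_frequently_atTop hC
  obtain ⟨x₀, φ, r, q, hφ, hw, -, hq, -, hxq⟩ :=
    hT.exists_subseq c (x := x ∘ ψ) fun k => (hψC k).le
  refine ⟨x₀, hF _ _ hw fun k => hxF _, fun y hy => hxq.trans ?_⟩
  have hlim : Tendsto (fun k => quadraticFunction T c y + ε (ψ (φ k)) * ‖y‖ ^ 2) atTop
      (𝓝 (quadraticFunction T c y + 0 * ‖y‖ ^ 2)) :=
    ((hε.comp (hψ.comp hφ).tendsto_atTop).mul_const _).const_add _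
  rw [zero_mul, add_zero] at hlim
  exact le_of_tendsto_of_tendsto' hq hlim fun k => hmin _ y hy

/-- If the quadratic function stays bounded along a sequence whose norms tend to infinity, then the
quadratic form tends to zero along the normalized sequence. -/
theorem tendsto_inner_normalized_of_bounded {T : H →L[ℝ] H} {c : H} {x : ℕ → H}
    (hnorm : Tendsto (fun k => ‖x k‖) atTop atTop) {L M : ℝ}
    (hL : ∀ k, L ≤ quadraticFunction T c (x k)) (hM : ∀ k, quadraticFunction T c (x k) ≤ M) :
    Tendsto (fun k => ⟪‖x k‖⁻¹ • x k, T (‖x k‖⁻¹ • x k)⟫) atTop (𝓝 0) := by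
  have hinv := hnorm.inv_tendsto_atTop
  have hbound : Tendsto (fun k => 2 * ((|L| + |M|) * ‖x k‖⁻¹ ^ 2 + ‖c‖ * ‖x k‖⁻¹)) atTop
      (𝓝 (2 * ((|L| + |M|) * 0 ^ 2 + ‖c‖ * 0))) :=
    (((hinv.pow 2).const_mul _).add (hinv.const_mul _)).const_mul 2
  simp only [ne_eq, OfNat.ofNat_ne_zero, not_false_eq_true, zero_pow, mul_zero, add_zero]
    at hbound
  refine squeeze_zero_norm' ?_ hbound
  filter_upwards [hnorm.eventually_gt_atTop 0] with k hk
  have hQ : ⟪x k, T (x k)⟫ = 2 * (quadraticFunction T c (x k) - ⟪c, x k⟫) := by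
    unfold quadraticFunction; ring
  have habs : |quadraticFunction T c (x k)| ≤ |L| + |M| := by
    refine abs_le.2 ⟨?_, ?_⟩
    · linarith [hL k, neg_abs_le L, abs_nonneg M]
    · linarith [hM k, le_abs_self M, abs_nonneg L]
  have hQle : |⟪x k, T (x k)⟫| ≤ 2 * ((|L| + |M|) + ‖c‖ * ‖x k‖) := by
    rw [hQ, abs_mul, abs_two]
    have := abs_sub (quadraticFunction T c (x k)) ⟪c, x k⟫
    linarith [abs_real_inner_le_norm c (x k)]
  have heq : ⟪‖x k‖⁻¹ • x k, T (‖x k‖⁻¹ • x k)⟫ = ‖x k‖⁻¹ ^ 2 * ⟪x k, T (x k)⟫ := by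
    simp only [map_smul, real_inner_smul_left, real_inner_smul_right]
    ring
  rw [heq, norm_mul, norm_pow, norm_inv, norm_norm, Real.norm_eq_abs]
  calc ‖x k‖⁻¹ ^ 2 * |⟪x k, T (x k)⟫|
      ≤ ‖x k‖⁻¹ ^ 2 * (2 * ((|L| + |M|) + ‖c‖ * ‖x k‖)) := by gcongr
    _ = 2 * ((|L| + |M|) * ‖x k‖⁻¹ ^ 2 + ‖c‖ * ‖x k‖⁻¹) := by field_simp

theorem eventually_norm_add_neg_smul_lt {x : ℕ → H} {v : H} (hv0 : v ≠ 0)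
    (hnorm : Tendsto (fun k => ‖x k‖) atTop atTop)
    (hv : WeaklyConvergesTo (fun k => ‖x k‖⁻¹ • x k) v) :
    ∀ᶠ k in atTop, ‖x k + (-1 : ℝ) • v‖ ^ 2 < ‖x k‖ ^ 2 := by
  have htop := hnorm.atTop_mul_pos (real_inner_self_pos.2 hv0) (hv v)
  filter_upwards [htop.eventually_gt_atTop (‖v‖ ^ 2), hnorm.eventually_gt_atTop 0] with k hk hk0
  rw [real_inner_smul_right, mul_inv_cancel_left₀ hk0.ne', real_inner_comm] at hk
  have : 0 ≤ ‖v‖ ^ 2 := by positivity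
  rw [neg_one_smul, ← sub_eq_add_neg, norm_sub_sq_real]
  linarith

theorem quadraticFunction_add_neg_smul_le {T : H →L[ℝ] H}
    (hT : ∀ x y : H, ⟪T x, y⟫ = ⟪x, T y⟫) {c x v : H} {L : ℝ} (hv : ⟪v, T v⟫ = 0)
    (hL : ∀ t : ℝ, 0 ≤ t → L ≤ quadraticFunction T c (x + t • v)) :
    quadraticFunction T c (x + (-1 : ℝ) • v) ≤ quadraticFunction T c x := by
  simp only [quadraticFunction_add_smul hT, hv, mul_zero, add_zero] at hL ⊢
  linarith [linearCoeff_nonneg_of_bddBelow hL]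

end Minimization

end HilbertSpace

/-- Frank–Wolfe-type theorem 1: if `⟪x, T x⟫` is a Legendre form, `F` is nonempty, `f` is
bounded from below on `F` and condition (A) holds, then `f` attains its infimum on `F`. -/
theorem frank_wolfe_type_1
    {H : Type*} [NormedAddCommGroup H] [InnerProductSpace ℝ H] [CompleteSpace H]
    {m : ℕ} (T : H →L[ℝ] H) (hT_sa : ∀ x y : H, ⟪T x, y⟫ = ⟪x, T y⟫) (c : H)
    (Ti : Fin m → H →L[ℝ] H)
    (hTi_sa : ∀ i, ∀ x y : H, ⟪Ti i x, y⟫ = ⟪x, Ti i y⟫)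
    (hTi_pos : ∀ i, ∀ x : H, 0 ≤ ⟪x, Ti i x⟫)
    (ci : Fin m → H) (α : Fin m → ℝ)
    (f : H → ℝ) (hf : ∀ x, f x = (1/2 : ℝ) * ⟪x, T x⟫ + ⟪c, x⟫)
    (F : Set H)
    (hF : F = {x : H | ∀ i, (1/2 : ℝ) * ⟪x, Ti i x⟫ + ⟪ci i, x⟫ + α i ≤ 0})
    (hLeg : IsLegendreForm T)
    (hne : F.Nonempty) (hbd : BddBelow (f '' F))
    (hA : ∀ v ∈ recessionCone F, ⟪v, T v⟫ = 0 → ∀ i, Ti i ≠ 0 → ⟪ci i, v⟫ = 0)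
    :
    ∃ xbar ∈ F, ∀ x ∈ F, f xbar ≤ f x := by
  have hf' : ∀ x, f x = quadraticFunction T c x := hf
  have hF' : F = quadraticFeasibleSet Ti ci fun i => -α i := by
    rw [hF]
    ext x
    refine forall_congr' fun i => ?_
    rw [quadraticFunction]
    exact ⟨fun h => by linarith, fun h => by linarith⟩
  clear hF
  subst hF'
  obtain ⟨L, hL⟩ := hbd
  replace hL : ∀ x ∈ quadraticFeasibleSet Ti ci fun i => -α i, L ≤ quadraticFunction T c x :=
    fun x hx => hf' x ▸ hL ⟨x, hx, rfl⟩
  simp only [hf']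
  have hclosed : ∀ (x : ℕ → H) (x₀ : H), WeaklyConvergesTo x x₀ →
      (∀ k, x k ∈ quadraticFeasibleSet Ti ci fun i => -α i) →
      x₀ ∈ quadraticFeasibleSet Ti ci fun i => -α i :=
    fun x x₀ h hx => h.mem_quadraticFeasibleSet hTi_sa hTi_pos (Eventually.of_forall hx)
  have hε : ∀ k : ℕ, (0 : ℝ) < 1 / ((k : ℝ) + 1) := fun k => Nat.one_div_pos_of_nat
  choose x hxF hmin using fun k => hLeg.exists_isMinOn_add_sq_norm hne hclosed hL (hε k)
  have hmin' : ∀ k, ∀ y ∈ quadraticFeasibleSet Ti ci fun i => -α i,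
      quadraticFunction T c (x k) ≤ quadraticFunction T c y + 1 / ((k : ℝ) + 1) * ‖y‖ ^ 2 := by
    intro k y hy
    have : 0 ≤ 1 / ((k : ℝ) + 1) * ‖x k‖ ^ 2 := mul_nonneg (hε k).le (sq_nonneg _)
    linarith [hmin k y hy]
  by_cases hnorm : Tendsto (fun k => ‖x k‖) atTop atTop
  · exfalso
    obtain ⟨y, hy⟩ := hne
    have hM : ∀ k, quadraticFunction T c (x k) ≤ quadraticFunction T c y + 1 * ‖y‖ ^ 2 := by
      intro k
      refine (hmin' k y hy).trans ?_
      gcongr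
      exact (div_le_one (by positivity)).2 (by linarith [k.cast_nonneg (α := ℝ)])
    have hball : ∀ k, ‖‖x k‖⁻¹ • x k‖ ≤ 1 := by
      intro k
      rw [norm_smul, norm_inv, norm_norm]
      exact inv_mul_le_one
    obtain ⟨v, φ, hφ, hv⟩ := exists_subseq_weaklyConvergesTo hball
    replace hnorm := hnorm.comp hφ.tendsto_atTop
    have hQ0 := tendsto_inner_normalized_of_bounded (x := x ∘ φ) hnorm
      (fun k => hL _ (hxF _)) fun k => hM _
    have hcone : v ∈ recessionCone (quadraticFeasibleSet Ti ci fun i => -α i) :=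
      mem_recessionCone_of_weaklyConvergesTo_normalized hTi_sa hTi_pos
        (x := x ∘ φ) (fun k => hxF _) hnorm hv
    have hvQ : ⟪v, T v⟫ = 0 := by
      have h1 := hLeg.inner_le_of_tendsto hv hQ0
      have h2 := quadraticCoeff_nonneg_of_bddBelow fun t ht =>
        (hL _ (hcone y hy t ht)).trans_eq (quadraticFunction_add_smul hT_sa c y v t)
      linarith
    have hv0 : v ≠ 0 := by
      rintro rfl
      have hstrong := (hLeg.2 _ _ hv (hvQ.symm ▸ hQ0)).norm
      have hone : Tendsto (fun k => ‖((fun k => ‖x k‖⁻¹ • x k) ∘ φ) k‖) atTop (𝓝 1) := by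
        refine tendsto_const_nhds.congr' ?_
        filter_upwards [hnorm.eventually_gt_atTop 0] with k hk
        simp only [Function.comp_apply] at hk ⊢
        rw [norm_smul, norm_inv, norm_norm, inv_mul_cancel₀ hk.ne']
      simpa using tendsto_nhds_unique hone hstrong
    obtain ⟨k, hkF, hkn⟩ := ((eventually_add_neg_smul_mem_quadraticFeasibleSet hTi_sa hTi_pos
      (x := x ∘ φ) (fun k => hxF _) hnorm hv (hA v hcone hvQ)).and
      (eventually_norm_add_neg_smul_lt (x := x ∘ φ) hv0 hnorm hv)).exists
    have hle := quadraticFunction_add_neg_smul_le hT_sa hvQ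
      fun t ht => hL _ (hcone _ (hxF (φ k)) t ht)
    have hlt := mul_lt_mul_of_pos_left hkn (hε (φ k))
    have := hmin (φ k) _ hkF
    simp only [Function.comp_apply] at hlt this
    linarith
  · rw [tendsto_atTop] at hnorm
    push Not at hnorm
    obtain ⟨C, hC⟩ := hnorm
    exact hLeg.exists_isMinOn_of_frequently_norm_lt hclosed hxF
      tendsto_one_div_add_atTop_nhds_zero_nat hmin' (hC.mono fun k hk => by simpa using hk)
end

section
/- Let x ↦ ⟨x, T x⟩ be a Legendre form on H. If the quadratic function f(x) = (1/2)⟨x, T x⟩ + ⟨c, x⟩ is bounded from below on all of H, then there exists x* ∈ H such that f(x*) ≤ f(x) for all x ∈ H. -/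
open scoped RealInnerProductSpace
open Filter Topology

/-- A sequence in the unit ball, orthogonal to the kernel of a symmetric operator `T`, converges
weakly to `0` as soon as its image under `T` converges to `0`. -/
theorem weaklyConvergesTo_zero_of_tendsto_map_zero
    {H : Type*} [NormedAddCommGroup H] [InnerProductSpace ℝ H] [CompleteSpace H]
    {T : H →L[ℝ] H} (hT : (T : H →ₗ[ℝ] H).IsSymmetric) {x : ℕ → H} (hx : ∀ k, ‖x k‖ ≤ 1)
    (hker : ∀ k, x k ∈ T.kerᗮ) (hTx : Tendsto (fun k => T (x k)) atTop (𝓝 0)) :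
    WeaklyConvergesTo x 0 := by
  intro a
  obtain ⟨p, hp, q, hq, rfl⟩ := T.ker.exists_add_mem_mem_orthogonal a
  have hpx (k : ℕ) : ⟪p, x k⟫ = 0 := hker k p hp
  have hq' : q ∈ closure (Set.range T) := by
    have hadj : ContinuousLinearMap.adjoint T = T :=
      (ContinuousLinearMap.isSelfAdjoint_iff_isSymmetric.mpr hT).adjoint_eq
    rw [ContinuousLinearMap.orthogonal_ker, hadj] at hq
    exact hq
  simp only [inner_add_left, hpx, zero_add, inner_zero_right]
  rw [Metric.tendsto_atTop]
  intro ε hε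
  obtain ⟨_, ⟨z, rfl⟩, hz⟩ := Metric.mem_closure_iff.mp hq' (ε / 2) (half_pos hε)
  have hTz : Tendsto (fun k => ⟪T z, x k⟫) atTop (𝓝 0) := by
    have h := (tendsto_const_nhds (x := z)).inner (𝕜 := ℝ) hTx
    rw [inner_zero_right] at h
    exact h.congr fun k => (hT z (x k)).symm
  obtain ⟨N, hN⟩ := Metric.tendsto_atTop.mp hTz (ε / 2) (half_pos hε)
  refine ⟨N, fun k hk => ?_⟩
  have h₁ := hN k hk
  rw [dist_zero_right, Real.norm_eq_abs] at h₁ ⊢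
  rw [dist_eq_norm] at hz
  have h₂ : |⟪q - T z, x k⟫| ≤ ‖q - T z‖ :=
    (abs_real_inner_le_norm _ _).trans (mul_le_of_le_one_right (norm_nonneg _) (hx k))
  have h₃ : ⟪q, x k⟫ = ⟪q - T z, x k⟫ + ⟪T z, x k⟫ := by rw [← inner_add_left, sub_add_cancel]
  rw [h₃]
  exact (abs_add_le _ _).trans_lt (by linarith)

/-- A symmetric operator inducing a Legendre form is bounded below on the orthogonal complement
of its kernel. -/
theorem IsLegendreForm.exists_norm_le_mul_norm_map
    {H : Type*} [NormedAddCommGroup H] [InnerProductSpace ℝ H] [CompleteSpace H]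
    {T : H →L[ℝ] H} (hLeg : IsLegendreForm T) (hT : (T : H →ₗ[ℝ] H).IsSymmetric) :
    ∃ C : ℝ, 0 ≤ C ∧ ∀ x ∈ T.kerᗮ, ‖x‖ ≤ C * ‖T x‖ := by
  by_contra! h
  choose! y hy hlt using fun n : ℕ => h (n + 1) (by positivity)
  have hpos (n : ℕ) : 0 < ‖y n‖ := lt_of_le_of_lt (by positivity) (hlt n)
  let x : ℕ → H := fun n => ‖y n‖⁻¹ • y n
  have hx (n : ℕ) : ‖x n‖ = 1 := by
    simp [x, norm_smul, (hpos n).ne']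
  have hTx : Tendsto (fun n => T (x n)) atTop (𝓝 0) := by
    refine squeeze_zero_norm (fun n => ?_) tendsto_one_div_add_atTop_nhds_zero_nat
    rw [map_smul, norm_smul, norm_inv, norm_norm, inv_mul_le_iff₀ (hpos n), mul_one_div,
      le_div_iff₀ (by positivity), mul_comm]
    exact (hlt n).le
  have hweak := weaklyConvergesTo_zero_of_tendsto_map_zero hT (fun n => (hx n).le)
    (fun n => Submodule.smul_mem _ _ (hy n)) hTx
  have hQ : Tendsto (fun n => ⟪x n, T (x n)⟫) atTop (𝓝 ⟪(0 : H), T 0⟫) := by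
    rw [inner_zero_left]
    refine squeeze_zero_norm (fun n => ?_) (tendsto_norm_zero.comp hTx)
    simpa [hx n] using norm_inner_le_norm (𝕜 := ℝ) (x n) (T (x n))
  have hnorm := (hLeg.2 x 0 hweak hQ).norm
  simp [hx] at hnorm

/-- A symmetric operator inducing a Legendre form has as range the orthogonal complement of its
kernel. -/
theorem IsLegendreForm.orthogonal_ker_eq_range
    {H : Type*} [NormedAddCommGroup H] [InnerProductSpace ℝ H] [CompleteSpace H]
    {T : H →L[ℝ] H} (hLeg : IsLegendreForm T) (hT : (T : H →ₗ[ℝ] H).IsSymmetric) :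
    T.kerᗮ = T.range := by
  obtain ⟨C, hC, hbound⟩ := hLeg.exists_norm_le_mul_norm_map hT
  let S : T.kerᗮ →L[ℝ] H := T.comp T.kerᗮ.subtypeL
  have hS : AntilipschitzWith ⟨C, hC⟩ S :=
    S.antilipschitz_of_bound fun x => hbound x x.2
  have hrange : Set.range S = Set.range T := by
    refine Set.Subset.antisymm (Set.range_subset_iff.mpr fun x => ⟨x, rfl⟩) ?_
    rintro _ ⟨z, rfl⟩
    obtain ⟨p, hp, q, hq, rfl⟩ := T.ker.exists_add_mem_mem_orthogonal z
    refine ⟨⟨q, hq⟩, ?_⟩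
    have hp' : T p = 0 := hp
    simp [S, hp']
  have hclosed : IsClosed (T.range : Set H) := by
    have h := hS.isClosed_range S.uniformContinuous
    rw [hrange] at h
    exact h
  have hadj : ContinuousLinearMap.adjoint T = T :=
    (ContinuousLinearMap.isSelfAdjoint_iff_isSymmetric.mpr hT).adjoint_eq
  rw [ContinuousLinearMap.orthogonal_ker, hadj]
  exact hclosed.submodule_topologicalClosure_eq

/-- A real quadratic polynomial bounded from below has nonnegative leading coefficient, and its
linear coefficient vanishes when the leading one does. -/
theorem quadratic_coeff_of_bounded_below {a b m : ℝ} (h : ∀ t : ℝ, m ≤ a * t ^ 2 + b * t) :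
    0 ≤ a ∧ (a = 0 → b = 0) := by
  constructor
  · have hm : m ≤ 0 := by simpa using h 0
    by_contra! ha
    have hsum (t : ℝ) : 2 * m ≤ 2 * (a * t ^ 2) := by linarith [h t, h (-t)]
    have key := hsum (1 + m / a)
    have hma : 0 ≤ m / a := div_nonneg_of_nonpos hm ha.le
    have heq : a * (m / a) = m := mul_div_cancel₀ m ha.ne
    nlinarith [mul_nonneg hma hma]
  · rintro rfl
    by_contra hb
    have key := h ((m - 1) / b)
    rw [mul_div_cancel₀ _ hb] at key
    linarith

/-- If `⟪x, T x⟫` is a Legendre form and `f(x) = (1/2)⟪x, T x⟫ + ⟪c, x⟫` is bounded from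
below on all of `H`, then `f` attains its global minimum. -/
theorem legendre_global_minimum
    {H : Type*} [NormedAddCommGroup H] [InnerProductSpace ℝ H] [CompleteSpace H]
    (T : H →L[ℝ] H) (hT_sa : ∀ x y : H, ⟪T x, y⟫ = ⟪x, T y⟫) (c : H)
    (f : H → ℝ) (hf : ∀ x, f x = (1/2 : ℝ) * ⟪x, T x⟫ + ⟪c, x⟫)
    (hLeg : IsLegendreForm T)
    (hbd : BddBelow (Set.range f)) :
    ∃ xs : H, ∀ x : H, f xs ≤ f x := by
  have hT : (T : H →ₗ[ℝ] H).IsSymmetric := hT_sa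
  obtain ⟨m, hm⟩ := hbd
  have hcoeff (x : H) := quadratic_coeff_of_bounded_below (a := 1 / 2 * ⟪x, T x⟫) (b := ⟪c, x⟫)
    (m := m) fun t => by
      have h := hm ⟨t • x, rfl⟩
      rw [hf, map_smul, inner_smul_left, inner_smul_right, inner_smul_right] at h
      simp only [conj_trivial] at h
      linarith
  have hc : -c ∈ T.kerᗮ := by
    intro x hx
    have hx' : T x = 0 := hx
    have h := (hcoeff x).2 (by simp [hx'])
    rw [inner_neg_right, real_inner_comm, h, neg_zero]
  rw [hLeg.orthogonal_ker_eq_range hT] at hc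
  obtain ⟨xs, hxs⟩ := hc
  have hxs' : T xs = -c := hxs
  refine ⟨xs, fun x => ?_⟩
  have hQ := (hcoeff (x - xs)).1
  have hcross : ⟪xs, T x⟫ = -⟪c, x⟫ := by rw [← hT_sa, hxs', inner_neg_left]
  rw [map_sub, inner_sub_left, inner_sub_right, inner_sub_right, hcross, hxs', inner_neg_right,
    inner_neg_right, real_inner_comm c x, real_inner_comm c xs] at hQ
  rw [hf, hf, hxs', inner_neg_right, real_inner_comm c xs]
  linarith
end
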